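/- Let H be a graph with δ(H) ≥ 1 having a d-sequence {H = ℋ₁,…,ℋ_s} with partial sums z_i(H) = Σ_{j=2}^i (m_j + 1 − d_j), and set Z = min{z_i(H) : 2 ≤ i ≤ s}; suppose Z ≤ 0. Let T be a forest without isolated vertices of order at least 3, let P_T be the set of pendant vertices of T adjacent to a vertex of degree at least 2, and let G = H + T be the disjoint union. If |P_T| − |N_T(P_T)| ≥ d_H − Z, then str(G) = |V(G)| + 1. -/

import Mathlib

open Finset

/-- A numbering of a graph of order `Fintype.card V` is a bijection onto `{1, …, card V}`. -/
def IsNumbering {V : Type*} [Fintype V] (f : V → ℕ) : Prop :=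
  Set.BijOn f Set.univ (Set.Icc 1 (Fintype.card V))

/-- The strength `str_f` of a numbering `f` of `G`: the maximum of `f u + f v` over edges. -/
noncomputable def strOf {V : Type*} [Fintype V] (G : SimpleGraph V) (f : V → ℕ) : ℕ :=
  sSup {n | ∃ u v, G.Adj u v ∧ n = f u + f v}

/-- The strength of a graph: the minimum over all numberings `f` of `str_f`. -/
noncomputable def strength {V : Type*} [Fintype V] (G : SimpleGraph V) : ℕ :=
  sInf {n | ∃ f : V → ℕ, IsNumbering f ∧ strOf G f = n}

open scoped Classical

/-- Degree of `v` inside the induced subgraph on `S`. -/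
noncomputable def degIn {V : Type*} (G : SimpleGraph V) (S : Finset V) (v : V) : ℕ :=
  (S.filter fun w => G.Adj v w).card

/-- The isolated vertices of the induced subgraph on `S`. -/
noncomputable def isolSet {V : Type*} (G : SimpleGraph V) (S : Finset V) : Finset V :=
  S.filter fun v => ∀ w ∈ S, ¬ G.Adj v w

/-- The non-isolated part of the induced subgraph on `S`. -/
noncomputable def core {V : Type*} (G : SimpleGraph V) (S : Finset V) : Finset V :=
  S \ isolSet G S

/-- The induced subgraph on `S` is terminal iff it is of the form `mK₁` with `m ≥ 1`, or
`mK₁ + K_r` with `m ≥ 0`, `r ≥ 2`. -/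
def Terminal {V : Type*} (G : SimpleGraph V) (S : Finset V) : Prop :=
  (core G S = ∅ ∧ S.Nonempty) ∨
    (2 ≤ (core G S).card ∧ ∀ v ∈ core G S, ∀ w ∈ core G S, v ≠ w → G.Adj v w)

/-- A d-sequence `𝒢₁, …, 𝒢ₛ` of `G`: `𝒢ᵢ` is the induced subgraph of `G` on `S i`
(so `𝒢ᵢ = mᵢK₁ + Gᵢ` where `Gᵢ` is induced on `core G (S i)`), `𝒢₁ = G`, and as long as
`𝒢ᵢ` is not terminal, `𝒢_{i+1}` is obtained from `Gᵢ` by deleting the chosen vertex `u i`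
together with all of its neighbors. -/
structure DSeq {V : Type*} [Fintype V] (G : SimpleGraph V) where
  s : ℕ
  hs : 1 ≤ s
  S : ℕ → Finset V
  u : ℕ → V
  first : S 1 = Finset.univ
  mem_u : ∀ i, 1 ≤ i → i < s → u i ∈ core G (S i)
  not_terminal : ∀ i, 1 ≤ i → i < s → ¬ Terminal G (S i)
  step : ∀ i, 1 ≤ i → i < s →
    S (i + 1) = (core G (S i)).filter fun w => w ≠ u i ∧ ¬ G.Adj (u i) w
  terminal : Terminal G (S s)

namespace DSeq

variable {V : Type*} [Fintype V] {G : SimpleGraph V}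

/-- `mᵢ`, the number of isolated vertices of `𝒢ᵢ`. -/
noncomputable def m (D : DSeq G) (i : ℕ) : ℕ := (isolSet G (D.S i)).card

/-- `dᵢ`, the degree in `Gᵢ` of the deleted vertex `u i` (for `i < s`); at the terminal
index it is the minimum degree of `Gₛ` (so `0` if `𝒢ₛ = mₛK₁`, and `r - 1` if `Gₛ = K_r`). -/
noncomputable def d (D : DSeq G) (i : ℕ) : ℕ :=
  if i < D.s then degIn G (D.S i) (D.u i)
  else if h : (core G (D.S i)).Nonempty then (core G (D.S i)).inf' h (degIn G (D.S i)) else 0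

/-- The partial sums `z_i = Σ_{j=2}^i (m_j + 1 - d_j)`. -/
noncomputable def z (D : DSeq G) (i : ℕ) : ℤ :=
  ∑ j ∈ Finset.Icc 2 i, ((D.m j : ℤ) + 1 - (D.d j : ℤ))

/-- A δ-sequence is a d-sequence in which every chosen vertex has minimum degree in `Gᵢ`. -/
def IsDeltaSeq (D : DSeq G) : Prop :=
  ∀ i, 1 ≤ i → i < D.s → ∀ w ∈ core G (D.S i), degIn G (D.S i) (D.u i) ≤ degIn G (D.S i) w

end DSeq

/-- The set of pendant vertices of `G` that are adjacent to a vertex of degree at least `2`. -/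
noncomputable def pendSet {V : Type*} [Fintype V] (G : SimpleGraph V) : Finset V :=
  Finset.univ.filter fun v =>
    degIn G Finset.univ v = 1 ∧ ∃ w, G.Adj v w ∧ 2 ≤ degIn G Finset.univ w

/-- The set of all neighbours of vertices of `A`. -/
noncomputable def nbrs {V : Type*} [Fintype V] (G : SimpleGraph V) (A : Finset V) : Finset V :=
  Finset.univ.filter fun w => ∃ v ∈ A, G.Adj w v

/-! ### Auxiliary material for the proof -/

section Aux

/-- A nonempty vertex set of a forest contains a vertex of degree at most one inside the set. -/
lemma exists_degIn_le_one {V : Type*} [Fintype V] (T : SimpleGraph V) (hT : T.IsAcyclic)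
    (S : Finset V) (hS : S.Nonempty) : ∃ v ∈ S, degIn T S v ≤ 1 := by
  have : Nonempty (S : Set V) := ⟨⟨hS.choose, hS.choose_spec⟩⟩
  have hI : (T.induce (S : Set V)).IsAcyclic := hT.induce _
  obtain ⟨u, v, p, hp, hmax⟩ :=
    SimpleGraph.Walk.exists_isPath_forall_isPath_length_le_length (T.induce (S : Set V))
  have key : ∀ w, (T.induce (S : Set V)).Adj u w → w = p.snd := by
    intro w hadj
    apply hI.eq_snd_of_adj_start hp hadj
    by_contra hw
    have h1 : (p.cons hadj.symm).IsPath := hp.cons hw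
    have := hmax _ _ _ h1
    simp at this
  refine ⟨u, u.2, ?_⟩
  unfold degIn
  rw [Finset.card_le_one]
  intro a ha b hb
  simp only [Finset.mem_filter] at ha hb
  have h1 := key ⟨a, ha.1⟩ (by simpa using ha.2)
  have h2 := key ⟨b, hb.1⟩ (by simpa using hb.2)
  exact congrArg Subtype.val (h1.trans h2.symm)

variable {V : Type*} [Fintype V]

lemma mem_nbrs {G : SimpleGraph V} {A : Finset V} {w : V} :
    w ∈ nbrs G A ↔ ∃ v ∈ A, G.Adj w v := by
  simp [nbrs]

/-- The balance of a set: its size minus the size of its neighbourhood. -/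
noncomputable def bal (G : SimpleGraph V) (A : Finset V) : ℤ :=
  (A.card : ℤ) - ((nbrs G A).card : ℤ)

/-- `S` is the set of vertices neither in `A` nor adjacent to `A`. -/
def Rem (G : SimpleGraph V) (A S : Finset V) : Prop :=
  ∀ x, x ∈ S ↔ x ∉ A ∧ x ∉ nbrs G A

/-- Independent sets which can be built one vertex at a time with balance at least `-c`. -/
inductive GoodC (G : SimpleGraph V) (c : ℤ) : Finset V → Prop
  | empty : GoodC G c ∅
  | cons (a : V) (A : Finset V) (ha : a ∉ A) (h : GoodC G c A) (hn : a ∉ nbrs G A)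
      (hb : -c ≤ bal G (Finset.cons a A ha)) : GoodC G c (Finset.cons a A ha)

lemma nbrs_empty (G : SimpleGraph V) : nbrs G ∅ = ∅ := by
  ext x; simp [mem_nbrs]

lemma bal_empty (G : SimpleGraph V) : bal G ∅ = 0 := by
  simp [bal, nbrs_empty]

lemma mem_nbrs_cons {G : SimpleGraph V} {A : Finset V} {a w : V} {ha : a ∉ A} :
    w ∈ nbrs G (Finset.cons a A ha) ↔ G.Adj w a ∨ w ∈ nbrs G A := by
  simp [mem_nbrs]

lemma bal_cons (G : SimpleGraph V) {A S : Finset V} (hR : Rem G A S) {a : V} (ha : a ∈ S) :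
    bal G (Finset.cons a A ((hR a).1 ha).1) = bal G A + 1 - degIn G S a := by
  have h1 : nbrs G (Finset.cons a A ((hR a).1 ha).1) =
      (nbrs G A) ∪ (S.filter fun w => G.Adj a w) := by
    ext w
    rw [mem_nbrs_cons, Finset.mem_union, Finset.mem_filter, hR w]
    constructor
    · rintro (h | h)
      · by_cases hw : w ∈ nbrs G A
        · exact Or.inl hw
        · refine Or.inr ⟨⟨fun hwA => ?_, hw⟩, h.symm⟩
          exact ((hR a).1 ha).2 (mem_nbrs.2 ⟨w, hwA, h.symm⟩)
      · exact Or.inl h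
    · rintro (h | h)
      · exact Or.inr h
      · exact Or.inl h.2.symm
  have h2 : Disjoint (nbrs G A) (S.filter fun w => G.Adj a w) := by
    rw [Finset.disjoint_left]
    intro x hx hx'
    exact ((hR x).1 (Finset.mem_filter.1 hx').1).2 hx
  unfold bal
  rw [h1, Finset.card_union_of_disjoint h2, Finset.card_cons]
  unfold degIn
  push_cast
  ring

lemma step_one {G : SimpleGraph V} {c : ℤ} {A S : Finset V} (hA : GoodC G c A)
    (hR : Rem G A S) {a : V} (ha : a ∈ S) (hb : -c ≤ bal G A + 1 - degIn G S a) :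
    ∃ A', GoodC G c A' ∧ bal G A' = bal G A + 1 - degIn G S a ∧
      Rem G A' (S.filter fun w => w ≠ a ∧ ¬ G.Adj a w) := by
  refine ⟨Finset.cons a A ((hR a).1 ha).1, ?_, bal_cons G hR ha, ?_⟩
  · exact GoodC.cons _ _ _ hA ((hR a).1 ha).2 (by rw [bal_cons G hR ha]; exact hb)
  · intro x
    rw [Finset.mem_filter, mem_nbrs_cons, Finset.mem_cons, hR x, G.adj_comm a x]
    tauto

lemma step_isol {G : SimpleGraph V} {c : ℤ} {A S : Finset V} (hA : GoodC G c A)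
    (hR : Rem G A S) (hb : -c ≤ bal G A) (I : Finset V) (hI : I ⊆ isolSet G S) :
    ∃ A', GoodC G c A' ∧ bal G A' = bal G A + I.card ∧ Rem G A' (S \ I) := by
  induction I using Finset.induction_on with
  | empty => exact ⟨A, hA, by simp, by simpa using hR⟩
  | insert a I haI ih =>
    obtain ⟨A', h1, h2, h3⟩ := ih (fun x hx => hI (Finset.mem_insert_of_mem hx))
    have haS := hI (Finset.mem_insert_self a I)
    simp only [isolSet, Finset.mem_filter] at haS
    have hd : degIn G (S \ I) a = 0 := by
      unfold degIn
      rw [Finset.card_eq_zero, Finset.filter_eq_empty_iff]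
      intro x hx
      exact haS.2 x (Finset.mem_sdiff.1 hx).1
    obtain ⟨A'', k1, k2, k3⟩ := step_one h1 h3 (a := a)
      (Finset.mem_sdiff.2 ⟨haS.1, haI⟩) (by rw [hd, h2]; push_cast; omega)
    refine ⟨A'', k1, ?_, ?_⟩
    · rw [k2, h2, hd, Finset.card_insert_of_notMem haI]; push_cast; ring
    · intro x
      rw [← k3 x, Finset.mem_filter, Finset.mem_sdiff, Finset.mem_sdiff, Finset.mem_insert]
      constructor
      · rintro ⟨hx, hx'⟩
        exact ⟨⟨hx, fun h => hx' (Or.inr h)⟩, fun h => hx' (Or.inl h), haS.2 x hx⟩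
      · rintro ⟨⟨hx, hx'⟩, hx2, _⟩
        exact ⟨hx, fun h => h.elim hx2 hx'⟩

lemma degIn_core (G : SimpleGraph V) {S : Finset V} {u : V} (hu : u ∈ core G S) :
    degIn G (core G S) u = degIn G S u := by
  unfold degIn
  congr 1
  ext x
  simp only [Finset.mem_filter, core, Finset.mem_sdiff, isolSet] at hu ⊢
  constructor
  · rintro ⟨⟨h, _⟩, h2⟩; exact ⟨h, h2⟩
  · rintro ⟨h, h2⟩
    exact ⟨⟨h, fun h3 => h3.2 u hu.1 h2.symm⟩, h2⟩

/-- One full stage of a d-sequence. -/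
lemma step_stage {G : SimpleGraph V} {c : ℤ} {A S : Finset V} (hA : GoodC G c A)
    (hR : Rem G A S) (hb : -c ≤ bal G A) {u : V} (hu : u ∈ core G S)
    (hb2 : -c ≤ bal G A + (isolSet G S).card + 1 - degIn G S u) :
    ∃ A', GoodC G c A' ∧ bal G A' = bal G A + (isolSet G S).card + 1 - degIn G S u ∧
      Rem G A' ((core G S).filter fun w => w ≠ u ∧ ¬ G.Adj u w) := by
  obtain ⟨A1, h1, h2, h3⟩ := step_isol hA hR hb (isolSet G S) (Finset.Subset.refl _)
  have h3' : Rem G A1 (core G S) := h3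
  obtain ⟨A2, k1, k2, k3⟩ := step_one h1 h3' hu (by rw [h2, degIn_core G hu]; exact hb2)
  exact ⟨A2, k1, by rw [k2, h2, degIn_core G hu], k3⟩

/-- Finishing greedily when the remaining graph is a forest. -/
lemma finish_forest {G : SimpleGraph V} (n : ℕ) : ∀ (A S : Finset V), S.card = n →
    GoodC G 0 A → 0 ≤ bal G A → Rem G A S →
    (∀ S' ⊆ S, S'.Nonempty → ∃ v ∈ S', degIn G S' v ≤ 1) →
    ∃ A', GoodC G 0 A' ∧ 0 ≤ bal G A' ∧ Rem G A' ∅ := by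
  induction n using Nat.strong_induction_on with
  | _ n ih =>
    intro A S hn hA hb hR hS
    rcases S.eq_empty_or_nonempty with rfl | hne
    · exact ⟨A, hA, hb, hR⟩
    · obtain ⟨v, hv, hd⟩ := hS S (Finset.Subset.refl _) hne
      obtain ⟨A', k1, k2, k3⟩ := step_one hA hR hv (by push_cast; omega)
      refine ih _ ?_ A' _ rfl k1 (by rw [k2]; omega) k3
        (fun S' hS' => hS S' (hS'.trans (Finset.filter_subset _ _)))
      rw [← hn]
      apply Finset.card_lt_card
      rw [Finset.filter_ssubset]
      exact ⟨v, hv, by simp⟩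

lemma card_nbrs_le {G : SimpleGraph V} {A : Finset V} (hA : GoodC G 0 A) :
    (nbrs G A).card ≤ A.card := by
  cases hA with
  | empty => simp [nbrs_empty]
  | cons a A ha h hn hb => unfold bal at hb; omega

lemma good_indep {G : SimpleGraph V} {c : ℤ} {A : Finset V} (hA : GoodC G c A) :
    ∀ a ∈ A, a ∉ nbrs G A := by
  induction hA with
  | empty => simp
  | cons a A ha h hn hb ih =>
    intro x hx
    rw [mem_nbrs_cons]
    rw [Finset.mem_cons] at hx
    rintro (h1 | h1)
    · rcases hx with rfl | hx
      · exact G.irrefl h1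
      · exact hn (mem_nbrs.2 ⟨x, hx, h1.symm⟩)
    · rcases hx with rfl | hx
      · exact hn h1
      · exact ih x hx h1

/-- Ranks for the vertices of a good set and of its neighbourhood. -/
lemma exists_rank {G : SimpleGraph V} {A : Finset V} (hA : GoodC G 0 A) :
    ∃ g : V → ℕ, (∀ a ∈ A, 1 ≤ g a ∧ g a ≤ A.card) ∧
      (∀ w ∈ nbrs G A, 1 ≤ g w ∧ g w ≤ (nbrs G A).card) ∧
      (∀ a ∈ A, ∀ b ∈ A, g a = g b → a = b) ∧
      (∀ a ∈ nbrs G A, ∀ b ∈ nbrs G A, g a = g b → a = b) ∧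
      (∀ a ∈ A, ∀ w, G.Adj a w → g w ≤ g a) := by
  induction hA with
  | empty => exact ⟨fun _ => 0, by simp [nbrs_empty]⟩
  | cons a A ha h hn hb ih =>
    obtain ⟨g, g1, g2, g3, g4, g5⟩ := ih
    have hgood : GoodC G 0 (Finset.cons a A ha) := GoodC.cons a A ha h hn hb
    have hind := good_indep hgood
    have hle := card_nbrs_le hgood
    set N := nbrs G A with hN
    set N' := nbrs G (Finset.cons a A ha) with hN'
    have hsub : N ⊆ N' := fun x hx => mem_nbrs_cons.2 (Or.inr hx)
    set D := N' \ N with hD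
    have hcard : D.card + N.card = N'.card := Finset.card_sdiff_add_card_eq_card hsub
    have haN' : a ∉ N' := hind a (Finset.mem_cons_self a A)
    have hAN' : ∀ x ∈ A, x ∉ N' := fun x hx => hind x (Finset.mem_cons_of_mem hx)
    let e : V → ℕ := fun x => if hx : x ∈ D then N.card + 1 + (D.equivFin ⟨x, hx⟩ : ℕ) else 0
    have he : ∀ x ∈ D, N.card + 1 ≤ e x ∧ e x ≤ N'.card := by
      intro x hx
      simp only [e, hx, dif_pos]
      have := (D.equivFin ⟨x, hx⟩).2
      omega
    have hei : ∀ x ∈ D, ∀ y ∈ D, e x = e y → x = y := by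
      intro x hx y hy hxy
      simp only [e, hx, hy, dif_pos] at hxy
      have : D.equivFin ⟨x, hx⟩ = D.equivFin ⟨y, hy⟩ := Fin.ext (by omega)
      exact congrArg Subtype.val (D.equivFin.injective this)
    have hcases : ∀ x ∈ N', x ∈ N ∨ x ∈ D := by
      intro x hx
      by_cases h : x ∈ N
      · exact Or.inl h
      · exact Or.inr (Finset.mem_sdiff.2 ⟨hx, h⟩)
    have hDN : ∀ x ∈ D, x ∉ N ∧ x ∈ N' := fun x hx =>
      ⟨(Finset.mem_sdiff.1 hx).2, (Finset.mem_sdiff.1 hx).1⟩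
    let g' : V → ℕ := fun x => if x = a then A.card + 1 else if x ∈ D then e x else g x
    have ga : g' a = A.card + 1 := by simp [g']
    have gA : ∀ x ∈ A, g' x = g x := by
      intro x hx
      have h1 : x ≠ a := fun h => ha (h ▸ hx)
      have h2 : x ∉ D := fun h => hAN' x hx (hDN x h).2
      simp [g', h1, h2]
    have gN : ∀ x ∈ N, g' x = g x := by
      intro x hx
      have h1 : x ≠ a := fun h => haN' (h ▸ hsub hx)
      have h2 : x ∉ D := fun h => (hDN x h).1 hx
      simp [g', h1, h2]
    have gD : ∀ x ∈ D, g' x = e x := by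
      intro x hx
      have h1 : x ≠ a := fun h => haN' (h ▸ (hDN x hx).2)
      simp [g', h1, hx]
    have hc : (Finset.cons a A ha).card = A.card + 1 := Finset.card_cons ha
    have hNle : N.card ≤ N'.card := Finset.card_le_card hsub
    have b2 : ∀ w ∈ N', 1 ≤ g' w ∧ g' w ≤ N'.card := by
      intro w hw
      rcases hcases w hw with h | h
      · have := g2 w h; rw [gN w h]; omega
      · have := he w h; rw [gD w h]; omega
    refine ⟨g', ?_, b2, ?_, ?_, ?_⟩
    · intro x hx
      rcases Finset.mem_cons.1 hx with rfl | hx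
      · rw [ga]; omega
      · have := g1 x hx
        rw [gA x hx]; omega
    · intro x hx y hy hxy
      rcases Finset.mem_cons.1 hx with hxa | hx <;>
        rcases Finset.mem_cons.1 hy with hya | hy
      · rw [hxa, hya]
      · have := g1 y hy
        rw [hxa, ga, gA y hy] at hxy; omega
      · have := g1 x hx
        rw [hya, ga, gA x hx] at hxy; omega
      · rw [gA x hx, gA y hy] at hxy
        exact g3 x hx y hy hxy
    · intro x hx y hy hxy
      rcases hcases x hx with h1 | h1 <;> rcases hcases y hy with h2 | h2
      · rw [gN x h1, gN y h2] at hxy; exact g4 x h1 y h2 hxy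
      · rw [gN x h1, gD y h2] at hxy
        have := g2 x h1; have := he y h2; omega
      · rw [gD x h1, gN y h2] at hxy
        have := g2 y h2; have := he x h1; omega
      · rw [gD x h1, gD y h2] at hxy; exact hei x h1 y h2 hxy
    · intro x hx w hw
      have hwN' : w ∈ N' := mem_nbrs.2 ⟨x, hx, hw.symm⟩
      rcases Finset.mem_cons.1 hx with rfl | hx
      · have := b2 w hwN'
        rw [ga]; omega
      · have hwN : w ∈ N := mem_nbrs.2 ⟨x, hx, hw.symm⟩
        rw [gA x hx, gN w hwN]
        exact g5 x hx w hw

lemma exists_numbering {G : SimpleGraph V} {A : Finset V} (hA : GoodC G 0 A)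
    (hR : Rem G A ∅) : ∃ f : V → ℕ, IsNumbering f ∧
      ∀ u v, G.Adj u v → f u + f v ≤ Fintype.card V + 1 := by
  obtain ⟨g, g1, g2, g3, g4, g5⟩ := exists_rank hA
  have hind := good_indep hA
  have hle := card_nbrs_le hA
  have hcov : ∀ x, x ∉ A → x ∈ nbrs G A := by
    intro x hx
    by_contra h
    have := (hR x).2 ⟨hx, h⟩
    simp at this
  have hp : A.card + (nbrs G A).card = Fintype.card V := by
    rw [← Finset.card_union_of_disjoint (Finset.disjoint_left.2 hind), ← Finset.card_univ]
    congr 1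
    ext x
    simp only [Finset.mem_union, Finset.mem_univ, iff_true]
    by_cases hx : x ∈ A
    · exact Or.inl hx
    · exact Or.inr (hcov x hx)
  let f : V → ℕ := fun x => if x ∈ A then Fintype.card V + 1 - g x else g x
  have fA : ∀ x ∈ A, f x = Fintype.card V + 1 - g x := fun x hx => by simp [f, hx]
  have fN : ∀ x, x ∉ A → f x = g x := fun x hx => by simp [f, hx]
  have hinj : Function.Injective f := by
    intro x y hxy
    by_cases hx : x ∈ A <;> by_cases hy : y ∈ A
    · rw [fA x hx, fA y hy] at hxy
      have := g1 x hx; have := g1 y hy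
      exact g3 x hx y hy (by omega)
    · rw [fA x hx, fN y hy] at hxy
      have := g1 x hx; have := g2 y (hcov y hy); omega
    · rw [fN x hx, fA y hy] at hxy
      have := g1 y hy; have := g2 x (hcov x hx); omega
    · rw [fN x hx, fN y hy] at hxy
      exact g4 x (hcov x hx) y (hcov y hy) hxy
  have hmaps : ∀ x, f x ∈ Finset.Icc 1 (Fintype.card V) := by
    intro x
    rw [Finset.mem_Icc]
    by_cases hx : x ∈ A
    · have := g1 x hx; rw [fA x hx]; omega
    · have := g2 x (hcov x hx); rw [fN x hx]; omega
  have himg : Finset.univ.image f = Finset.Icc 1 (Fintype.card V) := by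
    apply Finset.eq_of_subset_of_card_le
    · intro y hy
      obtain ⟨x, _, rfl⟩ := Finset.mem_image.1 hy
      exact hmaps x
    · rw [Finset.card_image_of_injective _ hinj]; simp
  refine ⟨f, ⟨fun x _ => by simpa using hmaps x, hinj.injOn, ?_⟩, ?_⟩
  · intro y hy
    have : y ∈ Finset.univ.image f := by rw [himg]; simpa using hy
    simpa using this
  · have key : ∀ u ∈ A, ∀ v, G.Adj u v → f u + f v ≤ Fintype.card V + 1 := by
      intro u hu v huv
      have hv : v ∉ A := fun hv => hind u hu (mem_nbrs.2 ⟨v, hv, huv⟩)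
      have := g5 u hu v huv
      have := g1 u hu
      rw [fA u hu, fN v hv]; omega
    intro u v huv
    by_cases hu : u ∈ A
    · exact key u hu v huv
    · by_cases hv : v ∈ A
      · rw [add_comm]; exact key v hv u huv.symm
      · have := g2 u (hcov u hu); have := g2 v (hcov v hv)
        rw [fN u hu, fN v hv]; omega

lemma strength_eq_of_numbering {G : SimpleGraph V} [Nonempty V] (hG : ∀ v, ∃ w, G.Adj v w)
    {f : V → ℕ} (hf : IsNumbering f)
    (hfe : ∀ u v, G.Adj u v → f u + f v ≤ Fintype.card V + 1) :
    strength G = Fintype.card V + 1 := by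
  apply le_antisymm
  · refine (Nat.sInf_le ⟨f, hf, rfl⟩ : strength G ≤ strOf G f).trans ?_
    obtain ⟨w, hw⟩ := hG (Classical.arbitrary V)
    refine csSup_le ⟨_, _, w, hw, rfl⟩ ?_
    rintro n ⟨u, v, huv, rfl⟩
    exact hfe u v huv
  · refine le_csInf ⟨_, f, hf, rfl⟩ ?_
    rintro n ⟨h, hh, rfl⟩
    obtain ⟨v, -, hv⟩ := hh.surjOn
      (show Fintype.card V ∈ Set.Icc 1 (Fintype.card V) from ⟨Fintype.card_pos, le_rfl⟩)
    obtain ⟨w, hw⟩ := hG v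
    have h1 := hh.mapsTo (Set.mem_univ w)
    have h2 : h v + h w ≤ strOf G h := by
      refine le_csSup ⟨2 * Fintype.card V, ?_⟩ ⟨v, w, hw, rfl⟩
      rintro n ⟨a, b, -, rfl⟩
      have ha := (hh.mapsTo (Set.mem_univ a)).2
      have hb := (hh.mapsTo (Set.mem_univ b)).2
      omega
    have := h1.1
    omega

/-- The pendant set is good. -/
lemma good_pend (T : SimpleGraph V) (Q : Finset V) (hQ : Q ⊆ pendSet T) : GoodC T 0 Q := by
  have hdeg : ∀ v ∈ pendSet T, ∀ w, T.Adj v w → 2 ≤ degIn T Finset.univ w := by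
    intro v hv w hw
    simp only [pendSet, Finset.mem_filter, Finset.mem_univ, true_and] at hv
    obtain ⟨h1, x, hx, hx2⟩ := hv
    have : w = x := Finset.card_le_one.1 (le_of_eq h1) w (by simpa using hw) x (by simpa using hx)
    rwa [this]
  have hone : ∀ v ∈ pendSet T, degIn T Finset.univ v = 1 := by
    intro v hv
    simp only [pendSet, Finset.mem_filter, Finset.mem_univ, true_and] at hv
    exact hv.1
  have hcard : ∀ Q ⊆ pendSet T, (nbrs T Q).card ≤ Q.card := by
    intro Q hQ
    have : nbrs T Q = Q.biUnion (fun v => Finset.univ.filter fun w => T.Adj v w) := by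
      ext w
      simp [mem_nbrs, T.adj_comm w]
    rw [this]
    refine (Finset.card_biUnion_le_card_mul _ _ 1 ?_).trans (by simp)
    intro v hv
    exact (hone v (hQ hv)).le
  induction Q using Finset.induction_on with
  | empty => exact GoodC.empty
  | insert a Q ha ih =>
    have h1 : Q ⊆ pendSet T := fun x hx => hQ (Finset.mem_insert_of_mem hx)
    have h2 := hQ (Finset.mem_insert_self a Q)
    rw [← Finset.cons_eq_insert a Q ha] at hQ ⊢
    refine GoodC.cons a Q ha (ih h1) ?_ ?_
    · intro h
      obtain ⟨v, hv, hav⟩ := mem_nbrs.1 h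
      have := hdeg a h2 v hav
      have := hone v (h1 hv)
      omega
    · have := hcard _ hQ
      unfold bal
      omega

/-- A d-sequence yields a good set exhausting the graph. -/
lemma good_dseq (H : SimpleGraph V) (D : DSeq H) (hs : 2 ≤ D.s) (Z : ℤ) (hZ0 : Z ≤ 0)
    (hZ : ∀ i, 2 ≤ i → i ≤ D.s → Z ≤ D.z i) (c : ℤ) (hc : (D.d 1 : ℤ) - Z ≤ c) :
    ∃ A, GoodC H c A ∧ Rem H A ∅ ∧ 1 - c ≤ bal H A := by
  have hd : ∀ i, i < D.s → D.d i = degIn H (D.S i) (D.u i) := by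
    intro i hi
    simp [DSeq.d, hi]
  have hz : ∀ i, 1 ≤ i → D.z (i + 1) = D.z i + ((D.m (i+1) : ℤ) + 1 - D.d (i+1)) := by
    intro i hi
    unfold DSeq.z
    rw [Finset.sum_Icc_succ_top (by omega)]
  have hzZ : ∀ i, 1 ≤ i → i ≤ D.s → Z ≤ D.z i := by
    intro i h1 h2
    rcases Nat.eq_or_lt_of_le h1 with rfl | h1
    · simpa [DSeq.z] using hZ0
    · exact hZ i h1 h2
  have main : ∀ i, 1 ≤ i → i + 1 ≤ D.s → ∃ A, GoodC H c A ∧ Rem H A (D.S (i+1)) ∧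
      1 - (D.d 1 : ℤ) + D.z i ≤ bal H A := by
    intro i hi
    induction i, hi using Nat.le_induction with
    | base =>
      intro h
      have hR : Rem H ∅ (D.S 1) := by
        intro x; simp [D.first, nbrs_empty]
      obtain ⟨A, h1, h2, h3⟩ := step_stage (c := c) GoodC.empty hR
        (by rw [bal_empty]; omega) (D.mem_u 1 le_rfl (by omega))
        (by rw [bal_empty, ← hd 1 (by omega)]; omega)
      refine ⟨A, h1, by rw [D.step 1 le_rfl (by omega)]; exact h3, ?_⟩
      rw [h2, bal_empty, ← hd 1 (by omega)]
      simp [DSeq.z]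
    | succ i hi ih =>
      intro h
      obtain ⟨A0, k1, k2, k3⟩ := ih (by omega)
      have z1 := hzZ i hi (by omega)
      have z2 := hzZ (i+1) (by omega) (by omega)
      have hzi := hz i hi
      have hdi := hd (i+1) (by omega)
      have hm : D.m (i+1) = (isolSet H (D.S (i+1))).card := rfl
      obtain ⟨A, h1, h2, h3⟩ := step_stage (c := c) k1 k2 (by omega)
        (D.mem_u (i+1) (by omega) (by omega)) (by rw [← hm, ← hdi]; omega)
      refine ⟨A, h1, by rw [D.step (i+1) (by omega) (by omega)]; exact h3, ?_⟩
      rw [h2, ← hm, ← hdi]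
      omega
  obtain ⟨t, ht⟩ : ∃ t, D.s = t + 1 := ⟨D.s - 1, by omega⟩
  obtain ⟨A0, k1, k2, k3⟩ := main t (by omega) (by omega)
  have z1 := hzZ t (by omega) (by omega)
  have z2 := hzZ (t+1) (by omega) (by omega)
  have hzi := hz t (by omega)
  have hm : D.m (t+1) = (isolSet H (D.S (t+1))).card := rfl
  have hterm := D.terminal
  rw [ht] at hterm
  rcases hterm with ⟨hcore, -⟩ | ⟨hcard, hcl⟩
  · obtain ⟨A, h1, h2, h3⟩ := step_isol k1 k2 (by omega) _ (Finset.Subset.refl _)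
    have h3' : Rem H A (core H (D.S (t+1))) := h3
    rw [hcore] at h3'
    exact ⟨A, h1, h3', by rw [h2]; omega⟩
  · have hne : (core H (D.S (t+1))).Nonempty := Finset.card_pos.1 (by omega)
    obtain ⟨u, hu, hdu⟩ := Finset.exists_mem_eq_inf' hne (degIn H (D.S (t+1)))
    have hds : D.d (t+1) = degIn H (D.S (t+1)) u := by
      rw [← hdu]
      unfold DSeq.d
      rw [if_neg (by omega), dif_pos hne]
    obtain ⟨A, h1, h2, h3⟩ := step_stage (c := c) k1 k2 (by omega) hu
      (by rw [← hm, ← hds]; omega)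
    refine ⟨A, h1, ?_, by rw [h2, ← hm, ← hds]; omega⟩
    have he : ((core H (D.S (t+1))).filter fun w => w ≠ u ∧ ¬ H.Adj u w) = ∅ := by
      rw [Finset.filter_eq_empty_iff]
      rintro x hx ⟨hxu, hxa⟩
      exact hxa (hcl u hu x hx (Ne.symm hxu))
    rwa [he] at h3

variable {W : Type*} [Fintype W]

lemma nbrs_disjSum (H : SimpleGraph V) (T : SimpleGraph W) (A : Finset V) (B : Finset W) :
    nbrs (H ⊕g T) (A.disjSum B) = (nbrs H A).disjSum (nbrs T B) := by
  ext x
  rcases x with x | x <;> simp [mem_nbrs]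

lemma bal_disjSum (H : SimpleGraph V) (T : SimpleGraph W) (A : Finset V) (B : Finset W) :
    bal (H ⊕g T) (A.disjSum B) = bal H A + bal T B := by
  unfold bal
  rw [nbrs_disjSum, Finset.card_disjSum, Finset.card_disjSum]
  push_cast
  ring

lemma good_right (H : SimpleGraph V) (T : SimpleGraph W) {B : Finset W} (hB : GoodC T 0 B) :
    GoodC (H ⊕g T) 0 ((∅ : Finset V).disjSum B) := by
  induction hB with
  | empty => exact GoodC.empty
  | cons b B hb' h hn hb ih =>
    have hnot : Sum.inr b ∉ (∅ : Finset V).disjSum B := by simpa using hb'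
    have he : (∅ : Finset V).disjSum (Finset.cons b B hb') =
        Finset.cons (Sum.inr b) ((∅ : Finset V).disjSum B) hnot := by
      ext x; rcases x with x | x <;> simp
    have hb2 : -0 ≤ bal (H ⊕g T) ((∅ : Finset V).disjSum (Finset.cons b B hb')) := by
      rw [bal_disjSum, bal_empty]; omega
    rw [he] at hb2 ⊢
    exact GoodC.cons _ _ hnot ih (by rw [nbrs_disjSum]; simpa using hn) hb2

lemma good_left (H : SimpleGraph V) (T : SimpleGraph W) {B : Finset W} (hB : GoodC T 0 B)
    {A : Finset V} (hA : GoodC H (bal T B) A) : GoodC (H ⊕g T) 0 (A.disjSum B) := by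
  induction hA with
  | empty => exact good_right H T hB
  | cons a A ha h hn hb ih =>
    have hnot : Sum.inl a ∉ A.disjSum B := by simpa using ha
    have he : (Finset.cons a A ha).disjSum B = Finset.cons (Sum.inl a) (A.disjSum B) hnot := by
      ext x; rcases x with x | x <;> simp
    have hb2 : -0 ≤ bal (H ⊕g T) ((Finset.cons a A ha).disjSum B) := by
      rw [bal_disjSum]; omega
    rw [he] at hb2 ⊢
    exact GoodC.cons _ _ hnot ih (by rw [nbrs_disjSum]; simpa using hn) hb2

lemma degIn_inr (H : SimpleGraph V) (T : SimpleGraph W) (S : Finset W) (v : W) :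
    degIn (H ⊕g T) ((∅ : Finset V).disjSum S) (Sum.inr v) = degIn T S v := by
  unfold degIn
  have : (((∅ : Finset V).disjSum S).filter fun w => (H ⊕g T).Adj (Sum.inr v) w) =
      (∅ : Finset V).disjSum (S.filter fun w => T.Adj v w) := by
    ext x; rcases x with x | x <;> simp
  rw [this, Finset.card_disjSum]
  simp

end Aux

/-- Let `H` be a graph with `δ(H) ≥ 1` having a d-sequence with minimal partial sum
`Z ≤ 0`, and let `T` be a forest without isolated vertices of order at least `3`. If
`|P_T| - |N_T(P_T)| ≥ d_H - Z`, then the disjoint union `G = H + T` satisfies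
`str(G) = |V(G)| + 1`. -/
theorem strength_sum_forest {α β : Type*} [Fintype α] [Fintype β]
    (H : SimpleGraph α) [DecidableRel H.Adj] (hδH : 1 ≤ H.minDegree)
    (DH : DSeq H) (Z : ℤ)
    (hZ : IsLeast {z | ∃ i, 2 ≤ i ∧ i ≤ DH.s ∧ z = DH.z i} Z) (hZ0 : Z ≤ 0)
    (T : SimpleGraph β) (hforest : T.IsAcyclic) (hiso : ∀ v : β, ∃ w, T.Adj v w)
    (hcard : 3 ≤ Fintype.card β)
    (hcond : (DH.d 1 : ℤ) - Z ≤ ((pendSet T).card : ℤ) - ((nbrs T (pendSet T)).card : ℤ)) :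
    strength (H ⊕g T) = Fintype.card (α ⊕ β) + 1 := by
  have hs : 2 ≤ DH.s := by
    obtain ⟨i, h1, h2, -⟩ := hZ.1
    omega
  obtain ⟨A, hA, hRA, hbA⟩ := good_dseq H DH hs Z hZ0
    (fun i h1 h2 => hZ.2 ⟨i, h1, h2, rfl⟩) (bal T (pendSet T)) hcond
  have hP := good_pend T (pendSet T) (Finset.Subset.refl _)
  have hG := good_left H T hP hA
  have hb : 0 ≤ bal (H ⊕g T) (A.disjSum (pendSet T)) := by
    rw [bal_disjSum]; omega
  let S : Finset β := Finset.univ.filter fun y => y ∉ pendSet T ∧ y ∉ nbrs T (pendSet T)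
  have hR : Rem (H ⊕g T) (A.disjSum (pendSet T)) ((∅ : Finset α).disjSum S) := by
    intro x
    rw [nbrs_disjSum]
    rcases x with x | x
    · have := hRA x
      simpa using this
    · simp [S]
  obtain ⟨A', h1, -, h3⟩ := finish_forest _ _ _ rfl hG hb hR (by
    intro S' hS' hne
    have hS'e : S' = (∅ : Finset α).disjSum S'.toRight := by
      ext x
      rcases x with x | x
      · simp only [Finset.inl_mem_disjSum, Finset.notMem_empty, iff_false]
        intro hx
        simpa using hS' hx
      · simp
    have hne' : S'.toRight.Nonempty := by
      rw [Finset.nonempty_iff_ne_empty]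
      intro h
      rw [h] at hS'e
      rw [hS'e] at hne
      simp at hne
    obtain ⟨v, hv, hd⟩ := exists_degIn_le_one T hforest _ hne'
    refine ⟨Sum.inr v, Finset.mem_toRight.1 hv, ?_⟩
    rw [hS'e, degIn_inr]
    exact hd)
  obtain ⟨f, hf, hfe⟩ := exists_numbering h1 h3
  have : Nonempty (α ⊕ β) := by
    have : 0 < Fintype.card β := by omega
    exact ⟨Sum.inr (Fintype.card_pos_iff.1 this).some⟩
  refine strength_eq_of_numbering ?_ hf hfe
  rintro (v | v)
  · have h : 0 < H.degree v := lt_of_lt_of_le hδH (H.minDegree_le_degree v)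
    obtain ⟨w, hw⟩ := (H.degree_pos_iff_exists_adj v).1 h
    exact ⟨Sum.inl w, by simpa using hw⟩
  · obtain ⟨w, hw⟩ := hiso v
    exact ⟨Sum.inr w, by simpa using hw⟩
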